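/- For any (possibly unbounded) adversary in the two-superposition game with parameters q, N: the challenger samples, for i ∈ [q], distinct x_i^0, x_i^1 ← [N] and b_i ← {0,1}, and sends the states σ_i = (1/√2)(|x_i^0⟩ + (−1)^{b_i}|x_i^1⟩); the adversary returns functions g_1, …, g_q : [N]×[N] → {0,1} and a value m; the adversary wins if m ∈ {x_s^0, x_s^1} for some index s and g_s(x_s^0, x_s^1) = b_s. Then for every t ∈ ℕ there exists N = O(q^2 t^2) such that the winning probability is at most 1/2 + 1/t; in particular for N = 128 q^2 the winning probability is at most 3/4. -/

import Mathlib

open Finset Matrix ComplexOrder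
open scoped Classical

noncomputable section

/-- Secrets of the two-superposition game: for each `i ∈ [q]` an ordered pair of
distinct elements `(x_i^0, x_i^1)` of `[N]` and a phase bit `b_i`. -/
abbrev TSSecrets (q N : ℕ) := (Fin q → {p : Fin N × Fin N // p.1 ≠ p.2}) × (Fin q → Bool)

/-- Adversary outputs: functions `g_1, …, g_q : [N] × [N] → {0,1}` and a value `m ∈ [N]`. -/
abbrev TSOut (q N : ℕ) := (Fin q → Fin N → Fin N → Bool) × Fin N

/-- The joint state `⊗_i (1/√2)(|x_i^0⟩ + (−1)^{b_i}|x_i^1⟩)` sent to the adversary. -/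
def tsState (q N : ℕ) (ω : TSSecrets q N) : (Fin q → Fin N) → ℂ := fun f =>
  ∏ i, (((Real.sqrt 2)⁻¹ : ℝ) : ℂ) *
    ((if f i = (ω.1 i).1.1 then 1 else 0) +
      (if ω.2 i then (-1 : ℂ) else 1) * (if f i = (ω.1 i).1.2 then 1 else 0))

/-- The adversary wins if `m ∈ {x_s^0, x_s^1}` for some `s` and `g_s(x_s^0, x_s^1) = b_s`. -/
def tsWins (q N : ℕ) (ω : TSSecrets q N) (o : TSOut q N) : Prop :=
  ∃ s : Fin q, (o.2 = (ω.1 s).1.1 ∨ o.2 = (ω.1 s).1.2) ∧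
    o.1 s (ω.1 s).1.1 (ω.1 s).1.2 = ω.2 s

/-- Winning probability of a POVM adversary `M` (acting on the received registers;
by Naimark dilation this captures arbitrary quantum strategies), averaged over the
uniformly random secrets. -/
def tsWinProb (q N : ℕ)
    (M : TSOut q N → Matrix (Fin q → Fin N) (Fin q → Fin N) ℂ) : ℝ :=
  (Fintype.card (TSSecrets q N) : ℝ)⁻¹ *
    ∑ ω : TSSecrets q N,
      ∑ o ∈ Finset.univ.filter (fun o => tsWins q N ω o),
        (star (tsState q N ω) ⬝ᵥ (M o *ᵥ tsState q N ω)).re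

/-- Secret of a single register. -/
abbrev TSU (N : ℕ) := {p : Fin N × Fin N // p.1 ≠ p.2} × Bool

/-- Single-register state. -/
def tsFac {N : ℕ} (u : TSU N) (y : Fin N) : ℂ :=
  (((Real.sqrt 2)⁻¹ : ℝ) : ℂ) *
    ((if y = u.1.1.1 then 1 else 0) +
      (if u.2 then (-1 : ℂ) else 1) * (if y = u.1.1.2 then 1 else 0))

lemma tsState_eq (q N : ℕ) (ω : TSSecrets q N) (f : Fin q → Fin N) :
    tsState q N ω f = ∏ i, tsFac (ω.1 i, ω.2 i) (f i) := rfl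

lemma sqrt2_inv_sq : (((Real.sqrt 2)⁻¹ : ℝ) : ℂ) * (((Real.sqrt 2)⁻¹ : ℝ) : ℂ) = 1 / 2 := by
  rw [← Complex.ofReal_mul, ← mul_inv, Real.mul_self_sqrt (by norm_num)]
  norm_num

lemma tsFac_norm {N : ℕ} (u : TSU N) : ∑ y, star (tsFac u y) * tsFac u y = 1 := by
  obtain ⟨⟨⟨x, z⟩, h⟩, b⟩ := u
  have h' : x ≠ z := h
  have key : ∀ y, star (tsFac (⟨⟨⟨x, z⟩, h⟩, b⟩ : TSU N) y) * tsFac (⟨⟨⟨x, z⟩, h⟩, b⟩ : TSU N) y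
      = (if y = x then (1/2 : ℂ) else 0) + (if y = z then (1/2 : ℂ) else 0) := by
    intro y
    unfold tsFac
    simp only [star_mul', Complex.star_def, Complex.conj_ofReal]
    rw [mul_mul_mul_comm, sqrt2_inv_sq]
    by_cases h1 : y = x
    · have h2 : y ≠ z := by rw [h1]; exact h'
      simp [h1, h']
    · by_cases h2 : y = z
      · cases b <;> simp [h2, h'.symm]
      · simp [h1, h2]
  simp only [key, Finset.sum_add_distrib, Finset.sum_ite_eq', Finset.mem_univ, if_true]
  norm_num

lemma prod_norm {ι : Type*} [Fintype ι] [DecidableEq ι] {N : ℕ} (r : ι → TSU N) :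
    ∑ f : ι → Fin N, star (∏ j, tsFac (r j) (f j)) * ∏ j, tsFac (r j) (f j) = 1 := by
  have : ∀ f : ι → Fin N, star (∏ j, tsFac (r j) (f j)) * ∏ j, tsFac (r j) (f j)
      = ∏ j, (star (tsFac (r j) (f j)) * tsFac (r j) (f j)) := by
    intro f
    rw [star_prod, Finset.prod_mul_distrib]
  simp only [this]
  rw [← Fintype.prod_sum (fun j y => star (tsFac (r j) y) * tsFac (r j) y)]
  simp only [tsFac_norm, Finset.prod_const_one]

/-- The quadratic form, i.e. outcome probability. -/
def qf {n : Type*} [Fintype n] (A : Matrix n n ℂ) (v : n → ℂ) : ℝ := (star v ⬝ᵥ (A *ᵥ v)).re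

lemma qf_nonneg {n : Type*} [Fintype n] {A : Matrix n n ℂ} (hA : A.PosSemidef) (v : n → ℂ) :
    0 ≤ qf A v := by
  have := hA.dotProduct_mulVec_nonneg v
  exact (Complex.le_def.1 this).1

lemma qf_sum {n O : Type*} [Fintype n] [DecidableEq n] [Fintype O] (A : O → Matrix n n ℂ) (h : ∑ o, A o = 1)
    (v : n → ℂ) (hv : ∑ y, star (v y) * v y = 1) : ∑ o, qf (A o) v = 1 := by
  unfold qf
  rw [← Complex.re_sum, ← dotProduct_sum, ← Matrix.sum_mulVec, h, one_mulVec]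
  unfold dotProduct
  simp only [Pi.star_apply]
  rw [hv]; rfl

/-- embedding of register `s` given the secrets of the other ones -/
def tsV {q N : ℕ} (s : Fin q) (r : {j // j ≠ s} → TSU N) : Matrix (Fin q → Fin N) (Fin N) ℂ :=
  fun f y => if f s = y then ∏ j : {j // j ≠ s}, tsFac (r j) (f j) else 0

lemma tsV_iso {q N : ℕ} (s : Fin q) (r : {j // j ≠ s} → TSU N) : (tsV s r)ᴴ * tsV s r = 1 := by
  ext y z
  rw [Matrix.mul_apply]
  simp only [Matrix.conjTranspose_apply]
  rw [← (Equiv.funSplitAt s (Fin N)).symm.sum_comp, Fintype.sum_prod_type]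
  have key : ∀ (a : Fin N) (f : {j // j ≠ s} → Fin N),
      star (tsV s r ((Equiv.funSplitAt s (Fin N)).symm (a, f)) y) *
        tsV s r ((Equiv.funSplitAt s (Fin N)).symm (a, f)) z =
      (if a = y then if a = z then 1 else 0 else 0) *
        (star (∏ j, tsFac (r j) (f j)) * ∏ j, tsFac (r j) (f j)) := by
    intro a f
    have h1 : (Equiv.funSplitAt s (Fin N)).symm (a, f) s = a := by simp
    have h2 : ∀ j : {j // j ≠ s}, (Equiv.funSplitAt s (Fin N)).symm (a, f) j = f j := by
      intro j
      simp [j.2]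
    unfold tsV
    simp only [h1, h2]
    split_ifs <;> simp
  simp only [key, ← Finset.mul_sum, prod_norm, mul_one, Finset.sum_ite_eq', Finset.mem_univ,
    if_true, Matrix.one_apply]

/-- assemble secrets -/
def tsMk {q N : ℕ} (s : Fin q) (r : {j // j ≠ s} → TSU N) (u : TSU N) : TSSecrets q N :=
  (fun i => if h : i = s then u.1 else (r ⟨i, h⟩).1,
   fun i => if h : i = s then u.2 else (r ⟨i, h⟩).2)

lemma tsMk_fst_self {q N : ℕ} (s : Fin q) (r : {j // j ≠ s} → TSU N) (u : TSU N) :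
    (tsMk s r u).1 s = u.1 := by simp [tsMk]

lemma tsMk_snd_self {q N : ℕ} (s : Fin q) (r : {j // j ≠ s} → TSU N) (u : TSU N) :
    (tsMk s r u).2 s = u.2 := by simp [tsMk]

lemma tsMk_fst_ne {q N : ℕ} (s : Fin q) (r : {j // j ≠ s} → TSU N) (u : TSU N)
    (j : Fin q) (h : j ≠ s) :
    (tsMk s r u).1 j = (r ⟨j, h⟩).1 := by simp [tsMk, h]

lemma tsMk_snd_ne {q N : ℕ} (s : Fin q) (r : {j // j ≠ s} → TSU N) (u : TSU N)
    (j : Fin q) (h : j ≠ s) :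
    (tsMk s r u).2 j = (r ⟨j, h⟩).2 := by simp [tsMk, h]

lemma sum_split {q N : ℕ} (s : Fin q) (F : TSSecrets q N → ℝ) :
    ∑ ω, F ω = ∑ r : {j // j ≠ s} → TSU N, ∑ u : TSU N, F (tsMk s r u) := by
  rw [Finset.sum_comm, ← Fintype.sum_prod_type']
  symm
  refine Fintype.sum_equiv ((Equiv.funSplitAt s (TSU N)).symm.trans
    (Equiv.arrowProdEquivProdArrow (Fin q) (fun _ => _) (fun _ => _))) _ _ ?_
  rintro ⟨u, r⟩
  congr 1
  ext i <;> by_cases h : i = s <;> simp [tsMk, Equiv.arrowProdEquivProdArrow, h]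

lemma tsState_mk {q N : ℕ} (s : Fin q) (r : {j // j ≠ s} → TSU N) (u : TSU N) :
    tsState q N (tsMk s r u) = tsV s r *ᵥ tsFac u := by
  funext f
  rw [tsState_eq, Fintype.prod_eq_mul_prod_subtype_ne _ s]
  simp only [mulVec, dotProduct, tsV, ite_mul, zero_mul, Finset.sum_ite_eq, Finset.mem_univ,
    if_true]
  rw [tsMk_fst_self, tsMk_snd_self, mul_comm]
  congr 1
  refine Finset.prod_congr rfl fun j _ => ?_
  rw [tsMk_fst_ne s r u j j.2, tsMk_snd_ne s r u j j.2]

lemma qf_mk {q N : ℕ} (s : Fin q) (r : {j // j ≠ s} → TSU N) (u : TSU N)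
    (A : Matrix (Fin q → Fin N) (Fin q → Fin N) ℂ) :
    qf A (tsState q N (tsMk s r u)) = qf ((tsV s r)ᴴ * A * tsV s r) (tsFac u) := by
  unfold qf
  rw [tsState_mk, star_mulVec, ← dotProduct_mulVec, mulVec_mulVec, mulVec_mulVec, Matrix.mul_assoc]

lemma sumP {N : ℕ} (F : Fin N → Fin N → ℝ) :
    ∑ p : {p : Fin N × Fin N // p.1 ≠ p.2}, F p.1.1 p.1.2 =
      ∑ x, ∑ y, if x ≠ y then F x y else 0 := by
  rw [← Fintype.sum_prod_type' (f := fun x y => if x ≠ y then F x y else 0),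
    ← Finset.sum_filter]
  symm
  exact Finset.sum_subtype _ (by simp) (fun p : Fin N × Fin N => F p.1 p.2)

lemma psd_cross {N : ℕ} {A : Matrix (Fin N) (Fin N) ℂ} (hA : A.PosSemidef) (x y : Fin N) (k : ℝ) :
    2 * k * (A x y).re ≤ (A x x).re + k ^ 2 * (A y y).re := by
  have h := qf_nonneg hA (Pi.single x 1 - Pi.single y (k : ℂ))
  have hh : A y x = star (A x y) := by
    rw [← Matrix.conjTranspose_apply, hA.1.eq]
  unfold qf at h
  simp only [mulVec_sub, star_sub, sub_dotProduct, dotProduct_sub, Pi.star_single, 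
    single_dotProduct, mulVec_single, star_one] at h
  simp [hh] at h
  nlinarith [h]

/-- sign of agreement -/
def chi (a b : Bool) : ℝ := if a = b then 1 else -1

lemma qf_fac {N : ℕ} {A : Matrix (Fin N) (Fin N) ℂ} (hA : A.PosSemidef)
    (p : {p : Fin N × Fin N // p.1 ≠ p.2}) (g : Bool) :
    ∑ b : Bool, chi g b * qf A (tsFac (p, b)) =
      (if g then -1 else 1) * (2 * (A p.1.1 p.1.2).re) := by
  obtain ⟨⟨x, y⟩, h⟩ := p
  have hh : A y x = star (A x y) := by
    rw [← Matrix.conjTranspose_apply, hA.1.eq]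
  have e : ∀ b : Bool, tsFac (⟨⟨x, y⟩, h⟩, b) = (((Real.sqrt 2)⁻¹ : ℝ) : ℂ) •
      (Pi.single x 1 + (if b then (-1 : ℂ) else 1) • Pi.single y (1 : ℂ) : Fin N → ℂ) := by
    intro b
    funext z
    by_cases hz : z = y <;> cases b <;> simp [tsFac, Pi.single_apply, hz]
  have e2 : ∀ b : Bool, qf A (tsFac (⟨⟨x, y⟩, h⟩, b)) =
      1 / 2 * ((A x x).re + (A y y).re + (if b then -1 else 1) * (2 * (A x y).re)) := by
    intro b
    unfold qf
    rw [e, mulVec_smul, star_smul, smul_dotProduct, dotProduct_smul, smul_smul, Complex.star_def,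
      Complex.conj_ofReal, sqrt2_inv_sq]
    simp only [mulVec_add, star_add, add_dotProduct, dotProduct_add, Pi.star_single, 
      single_dotProduct, mulVec_single, star_one, mulVec_smul, star_smul, smul_dotProduct, dotProduct_smul]
    cases b <;> simp [hh] <;> ring
  simp only [Fintype.sum_bool, e2, chi]
  cases g <;> simp <;> ring

/-- match indicator -/
def tsMt {N : ℕ} (m : Fin N) (p : {p : Fin N × Fin N // p.1 ≠ p.2}) : ℝ :=
  if m = p.1.1 ∨ m = p.1.2 then 1 else 0

lemma oneReg {N : ℕ} {O : Type*} [Fintype O] (A : O → Matrix (Fin N) (Fin N) ℂ)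
    (hA : ∀ o, (A o).PosSemidef) (h1 : ∑ o, A o = 1) (m : O → Fin N)
    (g : O → Fin N → Fin N → Bool) (k : ℝ) (hk : 0 < k) :
    ∑ u : TSU N, ∑ o, tsMt (m o) u.1 * chi (g o u.1.1.1 u.1.1.2) u.2 * qf (A o) (tsFac u) ≤
      2 * (N ^ 2 + k ^ 2 * N) / k := by
  have hdiag : ∀ o x, 0 ≤ (A o x x).re := fun o x => by
    have := psd_cross (hA o) x x 0
    simpa using this
  have habs : ∀ o x y, 2 * |(A o x y).re| ≤ ((A o x x).re + k ^ 2 * (A o y y).re) / k := by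
    intro o x y
    rw [le_div_iff₀ hk]
    have a1 := psd_cross (hA o) x y k
    have a2 := psd_cross (hA o) x y (-k)
    rcases abs_cases (A o x y).re with h | h <;> rw [h.1] <;> nlinarith
  have hsymm : ∀ o x y, (A o x y).re = (A o y x).re := by
    intro o x y
    have : A o y x = star (A o x y) := by
      rw [← Matrix.conjTranspose_apply, (hA o).1.eq]
    rw [this]; simp
  have hsum : ∀ x, ∑ o, (A o x x).re = 1 := by
    intro x
    have := congrFun (congrFun h1 x) x
    rw [Matrix.sum_apply] at this
    rw [← Complex.re_sum, this]; simp
  have step1 : ∀ o, ∑ u : TSU N, tsMt (m o) u.1 * chi (g o u.1.1.1 u.1.1.2) u.2 * qf (A o) (tsFac u)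
      ≤ 2 * ∑ y, ((A o (m o) (m o)).re + k ^ 2 * (A o y y).re) / k := by
    intro o
    set D : Fin N → ℝ := fun y => ((A o (m o) (m o)).re + k ^ 2 * (A o y y).re) / k with hD
    have hD0 : ∀ y, 0 ≤ D y := fun y => by
      have := hdiag o (m o); have := hdiag o y
      simp only [hD]; positivity
    rw [Fintype.sum_prod_type]
    have s1 : ∀ p : {p : Fin N × Fin N // p.1 ≠ p.2},
        ∑ b, tsMt (m o) p * chi (g o p.1.1 p.1.2) b * qf (A o) (tsFac (p, b)) ≤
        (if p.1.1 = m o then D p.1.2 else 0) + (if p.1.2 = m o then D p.1.1 else 0) := by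
      intro p
      simp only [mul_assoc]
      rw [← Finset.mul_sum, qf_fac (hA o)]
      have b1 : (if g o p.1.1 p.1.2 then (-1 : ℝ) else 1) * (2 * (A o p.1.1 p.1.2).re) ≤
          2 * |(A o p.1.1 p.1.2).re| := by
        have := neg_abs_le (A o p.1.1 p.1.2).re
        have := le_abs_self (A o p.1.1 p.1.2).re
        split_ifs <;> linarith
      have p1 := hD0 p.1.1
      have p2 := hD0 p.1.2
      unfold tsMt
      by_cases c1 : p.1.1 = m o
      · have : 2 * |(A o p.1.1 p.1.2).re| ≤ D p.1.2 := by
          simp only [hD]; rw [← c1]; exact habs _ _ _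
        rw [if_pos (Or.inl c1.symm), if_pos c1]
        split_ifs at * <;> linarith
      · by_cases c2 : p.1.2 = m o
        · have : 2 * |(A o p.1.1 p.1.2).re| ≤ D p.1.1 := by
            rw [hsymm]
            simp only [hD]; rw [← c2]; exact habs _ _ _
          rw [if_pos (Or.inr c2.symm), if_pos c2, if_neg c1]
          linarith
        · rw [if_neg (by tauto), if_neg c1, if_neg c2]; simp
    refine (Finset.sum_le_sum fun p _ => s1 p).trans ?_
    have s2 : ∑ p : {p : Fin N × Fin N // p.1 ≠ p.2},
        ((if p.1.1 = m o then D p.1.2 else 0) + (if p.1.2 = m o then D p.1.1 else 0)) ≤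
        ∑ p : Fin N × Fin N,
        ((if p.1 = m o then D p.2 else 0) + (if p.2 = m o then D p.1 else 0)) := by
      rw [sumP (fun x y => (if x = m o then D y else 0) + (if y = m o then D x else 0)),
        Fintype.sum_prod_type]
      refine Finset.sum_le_sum fun x _ => Finset.sum_le_sum fun y _ => ?_
      have := hD0 x
      have := hD0 y
      split_ifs <;> simp_all
    refine s2.trans (le_of_eq ?_)
    rw [Finset.sum_add_distrib, Fintype.sum_prod_type, Fintype.sum_prod_type_right]
    simp only [Finset.sum_ite_irrel, Finset.sum_const_zero, Finset.sum_ite_eq', Finset.mem_univ, if_true]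
    ring
  rw [Finset.sum_comm]
  refine (Finset.sum_le_sum fun o _ => step1 o).trans ?_
  rw [← Finset.mul_sum, mul_div_assoc]
  refine mul_le_mul_of_nonneg_left ?_ (by norm_num)
  simp only [← Finset.sum_div]
  refine div_le_div_of_nonneg_right ?_ hk.le
  simp only [Finset.sum_add_distrib, ← Finset.mul_sum]
  rw [Finset.sum_comm (f := fun o y => (A o y y).re)]
  simp only [hsum, Finset.sum_const, Finset.card_univ, Fintype.card_fin, nsmul_eq_mul, mul_one]
  have : ∑ o, (A o (m o) (m o)).re ≤ N := by
    calc ∑ o, (A o (m o) (m o)).re ≤ ∑ o, ∑ x, (A o x x).re :=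
          Finset.sum_le_sum fun o _ => Finset.single_le_sum (f := fun x => (A o x x).re)
            (fun x _ => hdiag o x) (Finset.mem_univ _)
      _ = N := by rw [Finset.sum_comm]; simp [hsum]
  rw [← Finset.mul_sum]
  nlinarith [Nat.cast_nonneg (α := ℝ) N]

lemma sumP_fst {N : ℕ} (v : Fin N) :
    ∑ p : {p : Fin N × Fin N // p.1 ≠ p.2}, (if p.1.1 = v then (1 : ℝ) else 0) = N - 1 := by
  rw [sumP (fun x y => if x = v then (1 : ℝ) else 0)]
  have : ∀ x, ∑ y : Fin N, (if x ≠ y then (if x = v then (1 : ℝ) else 0) else 0) =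
      if x = v then (N - 1 : ℝ) else 0 := by
    intro x
    by_cases h : x = v
    · have e : ∀ y : Fin N, (if x ≠ y then (if x = v then (1 : ℝ) else 0) else 0) =
          1 - if x = y then 1 else 0 := by
        intro y
        rw [if_pos h]
        by_cases h2 : x = y <;> simp [h2]
      simp only [e, Finset.sum_sub_distrib]
      simp [h]
    · simp [h]
  simp only [this]
  simp

lemma sumP_swap {N : ℕ} (F : Fin N → Fin N → ℝ) :
    ∑ p : {p : Fin N × Fin N // p.1 ≠ p.2}, F p.1.1 p.1.2 =
    ∑ p : {p : Fin N × Fin N // p.1 ≠ p.2}, F p.1.2 p.1.1 := by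
  rw [sumP, sumP (fun x y => F y x), Finset.sum_comm]
  simp only [ne_comm]

lemma sumP_snd {N : ℕ} (v : Fin N) :
    ∑ p : {p : Fin N × Fin N // p.1 ≠ p.2}, (if p.1.2 = v then (1 : ℝ) else 0) = N - 1 := by
  rw [← sumP_fst v]
  exact (sumP_swap (fun x _ => if x = v then (1 : ℝ) else 0)).symm

lemma cardP (N : ℕ) :
    ∑ _p : {p : Fin N × Fin N // p.1 ≠ p.2}, (1 : ℝ) = N * (N - 1) := by
  have : ∀ p : {p : Fin N × Fin N // p.1 ≠ p.2}, (1 : ℝ) = ∑ v, if p.1.1 = v then (1 : ℝ) else 0 := by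
    intro p; simp
  rw [Finset.sum_congr rfl fun p _ => this p, Finset.sum_comm]
  simp only [sumP_fst]
  simp [mul_sub]

/-- collision indicator -/
def tsCl {N : ℕ} (p p' : {p : Fin N × Fin N // p.1 ≠ p.2}) : ℝ :=
  if p.1.1 = p'.1.1 ∨ p.1.1 = p'.1.2 ∨ p.1.2 = p'.1.1 ∨ p.1.2 = p'.1.2 then 1 else 0

lemma sum_tsCl {N : ℕ} (p' : {p : Fin N × Fin N // p.1 ≠ p.2}) :
    ∑ u : TSU N, tsCl u.1 p' ≤ 8 * ((N : ℝ) - 1) := by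
  rw [Fintype.sum_prod_type]
  simp only [Finset.sum_const, Finset.card_univ, Fintype.card_bool, nsmul_eq_mul]
  rw [← Finset.mul_sum]
  have : ∀ p : {p : Fin N × Fin N // p.1 ≠ p.2}, tsCl p p' ≤
      (if p.1.1 = p'.1.1 then (1 : ℝ) else 0) + (if p.1.1 = p'.1.2 then (1 : ℝ) else 0) +
      (if p.1.2 = p'.1.1 then (1 : ℝ) else 0) + (if p.1.2 = p'.1.2 then (1 : ℝ) else 0) := by
    intro p
    unfold tsCl
    split_ifs <;> first | (exfalso; tauto) | norm_num
  have h := Finset.sum_le_sum (s := Finset.univ) fun p _ => this p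
  simp only [Finset.sum_add_distrib, sumP_fst, sumP_snd] at h
  push_cast
  linarith

lemma cardU (N : ℕ) : ∑ _u : TSU N, (1 : ℝ) = 2 * (N * (N - 1)) := by
  rw [Fintype.sum_prod_type, ← cardP, Finset.mul_sum]
  simp

/-- bounding a sum over secrets by conditioning on all but register `s`. -/
lemma sum_bound {q N : ℕ} (hN : 2 ≤ N) (s : Fin q) (F : TSSecrets q N → ℝ) (c : ℝ)
    (h : ∀ r : {j // j ≠ s} → TSU N, ∑ u : TSU N, F (tsMk s r u) ≤ c) :
    ∑ ω, F ω ≤ (Fintype.card (TSSecrets q N) : ℝ) * (c / (2 * (N * (N - 1)))) := by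
  have hN' : (2 : ℝ) ≤ N := by exact_mod_cast hN
  have hpos : (0 : ℝ) < 2 * (N * (N - 1)) := by
    have : (0 : ℝ) < N - 1 := by linarith
    positivity
  have hc : (Fintype.card (TSSecrets q N) : ℝ) =
      (Fintype.card ({j // j ≠ s} → TSU N) : ℝ) * (2 * (N * (N - 1))) := by
    have := sum_split s (fun _ : TSSecrets q N => (1 : ℝ))
    simp only [cardU] at this
    simpa only [Finset.sum_const, Finset.card_univ, nsmul_eq_mul, mul_one] using this
  rw [sum_split s F, hc, mul_assoc, mul_div_cancel₀ _ hpos.ne']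
  refine (Finset.sum_le_sum fun r _ => h r).trans ?_
  simp

lemma sum_mt_le {q N : ℕ} (x : Fin q → {p : Fin N × Fin N // p.1 ≠ p.2}) (m : Fin N) :
    ∑ s, tsMt m (x s) ≤ 1 + ∑ s, ∑ s', if s ≠ s' then tsCl (x s) (x s') else 0 := by
  have h01 : ∀ s, tsMt m (x s) * tsMt m (x s) = tsMt m (x s) := by
    intro s; unfold tsMt; split_ifs <;> simp
  have h1 : (∑ s, tsMt m (x s)) * (∑ s, tsMt m (x s)) - ∑ s, tsMt m (x s) ≤
      ∑ s, ∑ s', if s ≠ s' then tsCl (x s) (x s') else 0 := by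
    rw [Finset.sum_mul_sum, ← Finset.sum_sub_distrib]
    refine Finset.sum_le_sum fun s _ => ?_
    have e : tsMt m (x s) = ∑ s', if s = s' then tsMt m (x s) else 0 := by simp
    nth_rewrite 2 [e]
    rw [← Finset.sum_sub_distrib]
    refine Finset.sum_le_sum fun s' _ => ?_
    by_cases h : s = s'
    · subst h
      simp [h01]
    · simp only [h, if_false, ne_eq, not_false_eq_true, if_true, sub_zero]
      unfold tsMt tsCl
      split_ifs <;> norm_num
      exfalso
      grind
  nlinarith [sq_nonneg ((∑ s, tsMt m (x s)) - 1)]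

lemma wins_le {q N : ℕ} (ω : TSSecrets q N) (o : TSOut q N) :
    (if tsWins q N ω o then (1 : ℝ) else 0) ≤
      ∑ s, tsMt o.2 (ω.1 s) * ((1 + chi (o.1 s (ω.1 s).1.1 (ω.1 s).1.2) (ω.2 s)) / 2) := by
  have hnn : ∀ s, 0 ≤ tsMt o.2 (ω.1 s) *
      ((1 + chi (o.1 s (ω.1 s).1.1 (ω.1 s).1.2) (ω.2 s)) / 2) := by
    intro s
    unfold tsMt chi
    split_ifs <;> norm_num
  split_ifs with h
  · obtain ⟨s, h1, h2⟩ := h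
    refine le_trans ?_ (Finset.single_le_sum (fun s _ => hnn s) (Finset.mem_univ s))
    unfold tsMt chi
    rw [if_pos h1, if_pos h2]; norm_num
  · exact Finset.sum_nonneg fun s _ => hnn s

lemma winProb_le {q N : ℕ} (hN : 2 ≤ N) (k : ℝ) (hk : 0 < k)
    (M : TSOut q N → Matrix (Fin q → Fin N) (Fin q → Fin N) ℂ)
    (hM : ∀ o, (M o).PosSemidef) (h1 : ∑ o, M o = 1) :
    tsWinProb q N M ≤ 1 / 2 + q * q * (8 * ((N : ℝ) - 1) / (2 * (N * (N - 1)))) / 2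
      + q * ((2 * (N ^ 2 + k ^ 2 * N) / k) / (2 * (N * (N - 1)))) / 2 := by
  have hN' : (2 : ℝ) ≤ N := by exact_mod_cast hN
  set K : ℝ := (Fintype.card (TSSecrets q N) : ℝ) with hK
  have hKpos : 0 < K := by
    rw [hK]
    have : Nonempty (TSSecrets q N) :=
      ⟨(fun _ => ⟨(⟨0, by omega⟩, ⟨1, by omega⟩), by simp⟩, fun _ => true)⟩
    exact_mod_cast Fintype.card_pos
  set P : TSSecrets q N → TSOut q N → ℝ := fun ω o => qf (M o) (tsState q N ω) with hP
  have hP0 : ∀ ω o, 0 ≤ P ω o := fun ω o => qf_nonneg (hM o) _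
  have hP1 : ∀ ω, ∑ o, P ω o = 1 := fun ω =>
    qf_sum M h1 _ (prod_norm (fun i => (ω.1 i, ω.2 i)))
  -- cross terms
  have hT : ∀ s : Fin q, ∑ ω : TSSecrets q N, ∑ o : TSOut q N, tsMt o.2 (ω.1 s) *
      chi (o.1 s (ω.1 s).1.1 (ω.1 s).1.2) (ω.2 s) * P ω o ≤
      K * ((2 * (N ^ 2 + k ^ 2 * N) / k) / (2 * (N * (N - 1)))) := by
    intro s
    refine sum_bound hN s _ _ fun r => ?_
    simp only [hP, tsMk_fst_self, tsMk_snd_self, qf_mk]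
    refine oneReg (fun o => (tsV s r)ᴴ * M o * tsV s r)
      (fun o => (hM o).conjTranspose_mul_mul_same _) ?_ (fun o => o.2) (fun o => o.1 s) k hk
    rw [← Matrix.sum_mul, ← Matrix.mul_sum, h1, Matrix.mul_one, tsV_iso]
  -- collisions
  have hC : ∀ s s' : Fin q, ∑ ω : TSSecrets q N,
      (if s ≠ s' then tsCl (ω.1 s) (ω.1 s') else 0) ≤
      K * (8 * ((N : ℝ) - 1) / (2 * (N * (N - 1)))) := by
    intro s s'
    refine sum_bound hN s _ _ fun r => ?_
    by_cases h : s = s'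
    · simp only [h, ne_eq, not_true_eq_false, if_false, Finset.sum_const_zero]
      linarith
    · simp only [ne_eq, h, not_false_eq_true, if_true, tsMk_fst_self]
      have : ∀ u : TSU N, (tsMk s r u).1 s' = (r ⟨s', Ne.symm h⟩).1 := fun u =>
        tsMk_fst_ne s r u s' (Ne.symm h)
      simp only [this]
      exact sum_tsCl _
  have hA : ∑ ω : TSSecrets q N, ∑ o : TSOut q N, (∑ s, tsMt o.2 (ω.1 s)) * P ω o ≤
      K + q * q * (K * (8 * ((N : ℝ) - 1) / (2 * (N * (N - 1))))) := by
    calc _ ≤ ∑ ω : TSSecrets q N, ∑ o : TSOut q N,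
          (1 + ∑ s, ∑ s', if s ≠ s' then tsCl (ω.1 s) (ω.1 s') else 0) * P ω o :=
          Finset.sum_le_sum fun ω _ => Finset.sum_le_sum fun o _ =>
            mul_le_mul_of_nonneg_right (sum_mt_le ω.1 o.2) (hP0 ω o)
      _ = ∑ ω : TSSecrets q N,
          (1 + ∑ s, ∑ s', if s ≠ s' then tsCl (ω.1 s) (ω.1 s') else 0) := by
          simp only [← Finset.mul_sum, hP1, mul_one]
      _ = K + ∑ s, ∑ s', ∑ ω : TSSecrets q N,
          (if s ≠ s' then tsCl (ω.1 s) (ω.1 s') else 0) := by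
          rw [Finset.sum_add_distrib, Finset.sum_comm]
          congr 1
          · simp [hK]
          · exact Finset.sum_congr rfl fun s _ => Finset.sum_comm
      _ ≤ K + ∑ _s : Fin q, ∑ _s' : Fin q, K * (8 * ((N : ℝ) - 1) / (2 * (N * (N - 1)))) :=
          add_le_add le_rfl (Finset.sum_le_sum fun s _ => Finset.sum_le_sum fun s' _ => hC s s')
      _ = _ := by
          simp only [Finset.sum_const, Finset.card_univ, Fintype.card_fin, nsmul_eq_mul]
          ring
  have hW : ∑ ω : TSSecrets q N, ∑ o ∈ Finset.univ.filter (fun o => tsWins q N ω o), P ω o ≤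
      (∑ ω : TSSecrets q N, ∑ o : TSOut q N, (∑ s, tsMt o.2 (ω.1 s)) * P ω o) / 2 +
      (∑ s : Fin q, ∑ ω : TSSecrets q N, ∑ o : TSOut q N, tsMt o.2 (ω.1 s) *
        chi (o.1 s (ω.1 s).1.1 (ω.1 s).1.2) (ω.2 s) * P ω o) / 2 := by
    rw [Finset.sum_comm (s := (Finset.univ : Finset (Fin q))), Finset.sum_div, Finset.sum_div,
      ← Finset.sum_add_distrib]
    refine Finset.sum_le_sum fun ω _ => ?_
    rw [Finset.sum_comm (s := (Finset.univ : Finset (Fin q))), Finset.sum_div, Finset.sum_div,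
      ← Finset.sum_add_distrib, Finset.sum_filter]
    refine Finset.sum_le_sum fun o _ => ?_
    have := mul_le_mul_of_nonneg_right (wins_le ω o) (hP0 ω o)
    calc _ = (if tsWins q N ω o then (1 : ℝ) else 0) * P ω o := by split_ifs <;> simp
      _ ≤ _ := this
      _ = _ := by
        rw [Finset.sum_mul, Finset.sum_mul, ← add_div, ← Finset.sum_add_distrib, Finset.sum_div]
        refine Finset.sum_congr rfl fun s _ => ?_
        ring
  have hT' := Finset.sum_le_sum (s := (Finset.univ : Finset (Fin q))) fun s _ => hT s
  rw [Finset.sum_const, Finset.card_univ, Fintype.card_fin, nsmul_eq_mul] at hT'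
  have e : tsWinProb q N M =
      K⁻¹ * ∑ ω : TSSecrets q N, ∑ o ∈ Finset.univ.filter (fun o => tsWins q N ω o), P ω o := rfl
  rw [e, inv_mul_le_iff₀ hKpos]
  linarith

lemma winProb_le' {q t N : ℕ} (hq : 1 ≤ q) (ht : 1 ≤ t) (hN : N = 128 * q ^ 2 * t ^ 2)
    (M : TSOut q N → Matrix (Fin q → Fin N) (Fin q → Fin N) ℂ)
    (hM : ∀ o, (M o).PosSemidef) (h1 : ∑ o, M o = 1) :
    tsWinProb q N M ≤ 1 / 2 + 1 / (4 * (t : ℝ)) := by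
  have hq' : (1 : ℝ) ≤ q := by exact_mod_cast hq
  have ht' : (1 : ℝ) ≤ t := by exact_mod_cast ht
  have hN2 : 2 ≤ N := by
    have : 0 < q ^ 2 * t ^ 2 := by positivity
    rw [hN, mul_assoc]; omega
  have hNr : (N : ℝ) = 128 * (q * t) ^ 2 := by rw [hN]; push_cast; ring
  have hqt : (1 : ℝ) ≤ q * t := by nlinarith
  have hN1 : 127 * ((q : ℝ) * t) ^ 2 ≤ N - 1 := by rw [hNr]; nlinarith
  have hN1p : (0 : ℝ) < N - 1 := by nlinarith
  have hk : (0 : ℝ) < 8 * (q * t) := by positivity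
  refine (winProb_le hN2 (8 * (q * t)) hk M hM h1).trans ?_
  have hNp : (0 : ℝ) < N := by linarith
  have a1 : (q : ℝ) * q * (8 * ((N : ℝ) - 1) / (2 * (N * (N - 1)))) / 2 ≤ 1 / (64 * t) := by
    have : (q : ℝ) * q * (8 * ((N : ℝ) - 1) / (2 * (N * (N - 1)))) / 2 = 2 * q ^ 2 / N := by
      field_simp
      ring
    rw [this, div_le_div_iff₀ hNp (by positivity), hNr]
    have : (q : ℝ) ^ 2 * t ≤ q ^ 2 * t * t := le_mul_of_one_le_right (by positivity) ht'
    nlinarith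
  have a2 : (q : ℝ) * ((2 * ((N : ℝ) ^ 2 + (8 * (q * t)) ^ 2 * N) / (8 * (q * t))) /
      (2 * (N * (N - 1)))) / 2 ≤ 12 / (127 * t) := by
    have e1 : (q : ℝ) * ((2 * ((N : ℝ) ^ 2 + (8 * (q * t)) ^ 2 * N) / (8 * (q * t))) /
      (2 * (N * (N - 1)))) / 2 = q * (N + (8 * (q * t)) ^ 2) / (16 * (q * t)) / (N - 1) := by
      field_simp
      ring
    have e2 : q * ((N : ℝ) + (8 * (q * t)) ^ 2) / (16 * (q * t)) = 12 * q ^ 2 * t := by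
      rw [hNr]; field_simp; ring
    rw [e1, e2, div_le_div_iff₀ hN1p (by positivity)]
    nlinarith
  have a3 : 1 / (64 * (t : ℝ)) + 12 / (127 * t) ≤ 1 / (4 * t) := by
    have : (0 : ℝ) < t := by linarith
    have e : 1 / (64 * (t : ℝ)) + 12 / (127 * t) = (1 / 64 + 12 / 127) * (1 / t) := by field_simp
    have e' : 1 / (4 * (t : ℝ)) = 1 / 4 * (1 / t) := by field_simp
    rw [e, e']
    exact mul_le_mul_of_nonneg_right (by norm_num) (by positivity)
  linarith

/-- For every `t` there exists `N = O(q² t²)` such that no (even unbounded) adversary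
wins the two-superposition game with probability more than `1/2 + 1/t`; in particular
for `N = 128 q²` the winning probability is at most `3/4`. -/
theorem stmt_8 :
    (∃ C : ℕ, ∀ q t : ℕ, 1 ≤ q → 1 ≤ t → ∃ N : ℕ, 1 ≤ N ∧ N ≤ C * q ^ 2 * t ^ 2 ∧
      ∀ M : TSOut q N → Matrix (Fin q → Fin N) (Fin q → Fin N) ℂ,
        (∀ o, (M o).PosSemidef) → (∑ o, M o = 1) →
        tsWinProb q N M ≤ 1 / 2 + 1 / (t : ℝ))
    ∧ (∀ q : ℕ, 1 ≤ q →
        ∀ M : TSOut q (128 * q ^ 2) →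
            Matrix (Fin q → Fin (128 * q ^ 2)) (Fin q → Fin (128 * q ^ 2)) ℂ,
          (∀ o, (M o).PosSemidef) → (∑ o, M o = 1) →
          tsWinProb q (128 * q ^ 2) M ≤ 3 / 4) := by
  refine ⟨⟨128, fun q t hq ht => ⟨128 * q ^ 2 * t ^ 2, ?_, le_rfl, fun M hM h1 => ?_⟩⟩, ?_⟩
  · have : 0 < 128 * q ^ 2 * t ^ 2 := by positivity
    omega
  · refine (winProb_le' hq ht rfl M hM h1).trans ?_
    have ht' : (1 : ℝ) ≤ t := by exact_mod_cast ht
    have : 1 / (4 * (t : ℝ)) ≤ 1 / t :=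
      one_div_le_one_div_of_le (by linarith) (by linarith)
    linarith
  · intro q hq M hM h1
    have := winProb_le' (t := 1) hq le_rfl (by ring) M hM h1
    norm_num at this ⊢
    linarith

end
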